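/- arXiv:2003.14277 — 9 statements merged into one kernel-verified Lean document; each statement's English description precedes it below -/
import Mathlib

section
/- Let E be a finite-dimensional real inner product space, C ⊆ E a convex cone with nonempty interior, and f : E → ℝ a function which is concave and positively homogeneous on C and Fréchet differentiable at a point u in the interior of C. Assume in addition that u is a unit vector and that f(u) ≥ f(w) for every w ∈ C with ‖w‖ = 1. Then ∇f(u) = f(u) · u; equivalently, the unique linear functional φ with φ(u) = f(u) and φ ≥ f on C is given by φ(x) = f(u) · ⟨u, x⟩. -/
open scoped RealInnerProductSpace

/-- If a function touches `f` from above at `u`, the two derivatives at `u` agree. -/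
theorem HasFDerivAt.eq_of_eventually_le {E : Type*} [NormedAddCommGroup E] [NormedSpace ℝ E]
    {f g : E → ℝ} {f' g' : E →L[ℝ] ℝ} {u : E} (hf : HasFDerivAt f f' u) (hg : HasFDerivAt g g' u)
    (hle : ∀ᶠ x in nhds u, f x ≤ g x) (heq : f u = g u) : f' = g' := by
  have hmin : IsLocalMin (g - f) u := by
    filter_upwards [hle] with x hx
    simp only [Pi.sub_apply]
    linarith
  exact (sub_eq_zero.mp (hmin.hasFDerivAt_eq_zero (hg.sub hf))).symm

/-- At a unit vector, the derivative of the norm is the inner product with that vector. -/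
theorem hasFDerivAt_norm_of_norm_eq_one {E : Type*} [NormedAddCommGroup E]
    [InnerProductSpace ℝ E] {u : E} (hu : ‖u‖ = 1) :
    HasFDerivAt (fun x : E => ‖x‖) (innerSL ℝ u) u := by
  have h := (hasStrictFDerivAt_norm_sq u).hasFDerivAt.sqrt (by simp [hu])
  simp only [Real.sqrt_sq (norm_nonneg _)] at h
  convert h using 1
  ext x
  simp [hu]

/-- A derivative of a superadditive positively homogeneous function majorizes the function. -/
theorem HasFDerivAt.le_apply_of_superadditive {E : Type*} [NormedAddCommGroup E]
    [NormedSpace ℝ E] {C : Set E} {f : E → ℝ} {f' : E →L[ℝ] ℝ} {u x : E}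
    (hf : HasFDerivAt f f' u)
    (hC_smul : ∀ t : ℝ, 0 < t → ∀ x ∈ C, t • x ∈ C)
    (hhom : ∀ t : ℝ, 0 < t → ∀ x ∈ C, f (t • x) = t * f x)
    (hsuper : ∀ x ∈ C, ∀ y ∈ C, f x + f y ≤ f (x + y))
    (hu : u ∈ C) (hx : x ∈ C) : f x ≤ f' x := by
  refine ge_of_tendsto (hf.hasLineDerivAt x).tendsto_slope_zero_right ?_
  filter_upwards [self_mem_nhdsWithin] with t (ht : 0 < t)
  have h := hsuper u hu (t • x) (hC_smul t ht x hx)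
  rw [hhom t ht x hx] at h
  rw [smul_eq_mul, inv_mul_eq_div, le_div_iff₀ ht]
  linarith

/-- **Tangent functional at the maximal growth direction.**
If `f` is concave and positively homogeneous on a convex cone `C` with nonempty interior in a
finite-dimensional real inner product space, `f` is Fréchet differentiable at a unit vector `u`
in the interior of `C`, and `u` maximizes `f` among unit vectors of `C`, then
`∇f(u) = f(u) • u`; equivalently, the unique linear functional `φ` with `φ u = f u` and `φ ≥ f`
on `C` is `x ↦ f(u) * ⟪u, x⟫`. -/
theorem tangent_functional_at_maximal_direction
    {E : Type*} [NormedAddCommGroup E] [InnerProductSpace ℝ E] [FiniteDimensional ℝ E]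
    (C : Set E)
    (hC_add : ∀ x ∈ C, ∀ y ∈ C, x + y ∈ C)
    (hC_smul : ∀ t : ℝ, 0 < t → ∀ x ∈ C, t • x ∈ C)
    (f : E → ℝ)
    (hconc : ∀ x ∈ C, ∀ y ∈ C, ∀ l : ℝ, 0 ≤ l → l ≤ 1 →
      l * f x + (1 - l) * f y ≤ f (l • x + (1 - l) • y))
    (hhom : ∀ t : ℝ, 0 < t → ∀ x ∈ C, f (t • x) = t * f x)
    (u : E) (hu : u ∈ interior C)
    (hdiff : DifferentiableAt ℝ f u)
    (hunit : ‖u‖ = 1)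
    (hmax : ∀ w ∈ C, ‖w‖ = 1 → f w ≤ f u) :
    gradient f u = f u • u ∧
      ((∀ x ∈ C, f x ≤ f u * ⟪u, x⟫) ∧
        ∀ φ : E →ₗ[ℝ] ℝ, φ u = f u → (∀ x ∈ C, f x ≤ φ x) →
          ∀ x : E, φ x = f u * ⟪u, x⟫) := by
  have huC : u ∈ C := interior_subset hu
  have hnhds : C ∈ nhds u := mem_interior_iff_mem_nhds.mp hu
  have hsuper : ∀ x ∈ C, ∀ y ∈ C, f x + f y ≤ f (x + y) := by
    intro x hx y hy
    have h := hconc _ (hC_smul 2 two_pos x hx) _ (hC_smul 2 two_pos y hy) (1 / 2)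
      (by norm_num) (by norm_num)
    rw [hhom 2 two_pos x hx, hhom 2 two_pos y hy, smul_smul, smul_smul] at h
    norm_num at h
    linarith
  have hbound : ∀ᶠ x in nhds u, f x ≤ f u * ‖x‖ := by
    have hne : u ≠ 0 := norm_ne_zero_iff.mp (by simp [hunit])
    filter_upwards [hnhds, isOpen_ne.mem_nhds hne] with x hx hx0
    have hpos : 0 < ‖x‖ := norm_pos_iff.mpr hx0
    have h := hmax _ (hC_smul _ (inv_pos.mpr hpos) x hx)
      (by rw [norm_smul, norm_inv, norm_norm, inv_mul_cancel₀ hpos.ne'])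
    rwa [hhom _ (inv_pos.mpr hpos) x hx, inv_mul_eq_div, div_le_iff₀ hpos] at h
  have hf' : fderiv ℝ f u = f u • innerSL ℝ u :=
    hdiff.hasFDerivAt.eq_of_eventually_le
      ((hasFDerivAt_norm_of_norm_eq_one hunit).const_mul (f u)) hbound (by simp [hunit])
  have happly : ∀ x, fderiv ℝ f u x = f u * ⟪u, x⟫ := fun x => by simp [hf']
  refine ⟨?_, fun x hx => ?_, fun φ hφu hφ x => ?_⟩
  · refine ext_inner_right ℝ fun x => ?_
    rw [inner_gradient_left, happly, real_inner_smul_left]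
  · rw [← happly]
    exact hdiff.hasFDerivAt.le_apply_of_superadditive hC_smul hhom hsuper huC hx
  · have h : fderiv ℝ f u = φ.toContinuousLinearMap :=
      hdiff.hasFDerivAt.eq_of_eventually_le φ.toContinuousLinearMap.hasFDerivAt
        (Filter.mem_of_superset hnhds hφ) hφu.symm
    rw [← happly, h]
    rfl
end

section
/- Let Γ be a countable group acting measurably on a standard Borel space F, let r ≥ 1, and let σ : Γ × F → ℝ^r be a measurable cocycle, i.e. σ(γ₁γ₂, ξ) = σ(γ₁, γ₂ξ) + σ(γ₂, ξ) for all γ₁, γ₂ ∈ Γ and ξ ∈ F. For i = 1, 2 let ψ_i : ℝ^r → ℝ be a linear form and ν_i a σ-finite Borel measure on F satisfying the conformality relation d(γ_*ν_i)/dν_i (ξ) = e^{−ψ_i(σ(γ^{−1}, ξ))} for all γ ∈ Γ and ν_i-a.e. ξ. Let F⁽²⁾ ⊆ F × F be a Borel subset invariant under the diagonal Γ-action, and let β : F⁽²⁾ × ℝ^r → ℝ^r be a measurable map satisfying β(γξ, γη, b + σ(γ, η)) = β(ξ, η, b) + σ(γ, ξ) for all γ ∈ Γ, (ξ, η) ∈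 F⁽²⁾ and b ∈ ℝ^r. Define the measure m on F⁽²⁾ × ℝ^r by dm(ξ, η, b) = e^{ψ₁(β(ξ, η, b)) + ψ₂(b)} dν₁(ξ) dν₂(η) db, where db is Lebesgue measure on ℝ^r. Then m is invariant under the Γ-action γ · (ξ, η, b) = (γξ, γη, b + σ(γ, η)). Moreover, if there is a linear map L : ℝ^r → ℝ^r with β(ξ, η, b + c) = β(ξ, η, b) + L(c) for all (ξ, η) ∈ F⁽²⁾ and b, c ∈ ℝ^r, then for every c ∈ ℝ^r the translation T_c(ξ, η, b) = (ξ, η, b + c) satisfies (T_c)_*m = e^{−ψ₁(L(c)) − ψ₂(c)} · m. -/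
open MeasureTheory

namespace MeasureTheory

/-- Change of variables for a measure with density: if `g` pushes `μ` to a measure with density `D`
and `w` factors through `g` as `K ∘ g`, then `g` pushes `w • μ` to `(D * K) • μ`. -/
theorem Measure.map_withDensity_of_eq_comp {X : Type*} [MeasurableSpace X] {μ : Measure X}
    {g : X → X} (hg : Measurable g) {D K w : X → ENNReal} (hD : Measurable D) (hK : Measurable K)
    (hmap : μ.map g = μ.withDensity D) (hw : ∀ x, w x = K (g x)) :
    (μ.withDensity w).map g = μ.withDensity (D * K) := by
  rw [withDensity_mul _ hD hK, ← hmap]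
  ext s hs
  rw [Measure.map_apply hg hs, withDensity_apply _ (hg hs), withDensity_apply _ hs,
    setLIntegral_map hs hK hg]
  simp only [hw]

/-- The push-forward of `ν₁ × ν₂ × κ`, with `κ` right invariant, under a skew product over two maps
transforming `ν₁` and `ν₂` by densities. -/
theorem Measure.map_prod_prod_add_eq_withDensity {X Y V : Type*} [MeasurableSpace X]
    [MeasurableSpace Y] [MeasurableSpace V] [AddGroup V] [MeasurableAdd₂ V]
    {ν₁ : Measure X} {ν₂ : Measure Y} {κ : Measure V} [SFinite ν₁] [SFinite ν₂] [SFinite κ]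
    [κ.IsAddRightInvariant] {f : X → X} {g : Y → Y} {s : Y → V} (hf : Measurable f)
    (hg : Measurable g) (hs : Measurable s) {d₁ : X → ENNReal} {d₂ : Y → ENNReal}
    (hd₁ : Measurable d₁) (hd₂ : Measurable d₂) (h₁ : ν₁.map f = ν₁.withDensity d₁)
    (h₂ : ν₂.map g = ν₂.withDensity d₂) :
    (ν₁.prod (ν₂.prod κ)).map (fun p => (f p.1, g p.2.1, p.2.2 + s p.2.1)) =
      (ν₁.prod (ν₂.prod κ)).withDensity (fun p => d₁ p.1 * d₂ p.2.1) := by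
  refine Measure.ext_of_lintegral _ fun h hh => ?_
  have hint : Measurable fun q : X × Y => ∫⁻ b, h (q.1, q.2, b) ∂κ :=
    Measurable.lintegral_prod_right' (f := fun q : (X × Y) × V => h (q.1.1, q.1.2, q.2))
      (by fun_prop)
  have hslice : ∀ x, Measurable fun y => ∫⁻ b, h (x, y, b) ∂κ := fun x =>
    hint.comp measurable_prodMk_left
  have hint' : Measurable fun x => ∫⁻ y, ∫⁻ b, h (x, y, b) ∂κ ∂(ν₂.map g) :=
    hint.lintegral_prod_right'
  have left : ∫⁻ p, h p ∂(ν₁.prod (ν₂.prod κ)).map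
        (fun p => (f p.1, g p.2.1, p.2.2 + s p.2.1)) =
      ∫⁻ x, ∫⁻ y, ∫⁻ b, h (x, y, b) ∂κ ∂(ν₂.map g) ∂(ν₁.map f) := by
    rw [lintegral_map hh (by fun_prop), lintegral_prod _ (by fun_prop), lintegral_map hint' hf]
    refine lintegral_congr fun x => ?_
    rw [lintegral_prod _ (by fun_prop), lintegral_map (hslice (f x)) hg]
    exact lintegral_congr fun y =>
      lintegral_add_right_eq_self (fun b => h (f x, g y, b)) (s y)
  rw [left, lintegral_withDensity_eq_lintegral_mul _ (by fun_prop) hh,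
    lintegral_prod _ (by fun_prop), h₁, lintegral_withDensity_eq_lintegral_mul _ hd₁ hint', h₂]
  refine lintegral_congr fun x => ?_
  rw [lintegral_prod _ (by fun_prop), Pi.mul_apply,
    lintegral_withDensity_eq_lintegral_mul _ hd₂ (hslice x),
    ← lintegral_const_mul _ (by fun_prop)]
  refine lintegral_congr fun y => ?_
  simp only [Pi.mul_apply]
  rw [lintegral_const_mul _ (by fun_prop), mul_assoc]

end MeasureTheory

/-- **Invariance and quasi-invariance of the generalized Bowen–Margulis–Sullivan measure.**
Given a countable group `Γ` acting measurably on a standard Borel space `F`, a measurable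
`ℝʳ`-valued cocycle `σ`, two conformal measures `ν₁, ν₂` for linear forms `ψ₁, ψ₂`, a
`Γ`-invariant Borel set `F⁽²⁾ ⊆ F × F`, and an equivariant map `β`, the measure
`dm = e^{ψ₁(β(ξ,η,b)) + ψ₂(b)} dν₁(ξ) dν₂(η) db` on `F⁽²⁾ × ℝʳ` is invariant under
`γ·(ξ,η,b) = (γξ, γη, b + σ(γ,η))`; moreover if `β` is affine in `b` with linear part `L`, then
the translation `T_c` scales `m` by `e^{-ψ₁(L c) - ψ₂ c}`. -/
theorem bms_measure_invariant_and_quasi_invariant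
    {F : Type*} [MeasurableSpace F] [StandardBorelSpace F]
    {Γ : Type*} [Group Γ] [Countable Γ] [MulAction Γ F]
    (hact : ∀ γ : Γ, Measurable fun ξ : F => γ • ξ)
    (r : ℕ) (hr : 1 ≤ r)
    (σ : Γ → F → (Fin r → ℝ))
    (hσ_meas : ∀ γ : Γ, Measurable (σ γ))
    (hσ_cocycle : ∀ γ₁ γ₂ : Γ, ∀ ξ : F, σ (γ₁ * γ₂) ξ = σ γ₁ (γ₂ • ξ) + σ γ₂ ξ)
    (ψ₁ ψ₂ : (Fin r → ℝ) →ₗ[ℝ] ℝ)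
    (ν₁ ν₂ : Measure F) [SigmaFinite ν₁] [SigmaFinite ν₂]
    (hconf₁ : ∀ γ : Γ, Measure.map (fun ξ : F => γ • ξ) ν₁ =
      ν₁.withDensity fun ξ => ENNReal.ofReal (Real.exp (-(ψ₁ (σ γ⁻¹ ξ)))))
    (hconf₂ : ∀ γ : Γ, Measure.map (fun ξ : F => γ • ξ) ν₂ =
      ν₂.withDensity fun ξ => ENNReal.ofReal (Real.exp (-(ψ₂ (σ γ⁻¹ ξ)))))
    (F2 : Set (F × F)) (hF2_meas : MeasurableSet F2)
    (hF2_inv : ∀ γ : Γ, ∀ p ∈ F2, (γ • p.1, γ • p.2) ∈ F2)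
    (β : F → F → (Fin r → ℝ) → (Fin r → ℝ))
    (hβ_meas : Measurable fun p : F × F × (Fin r → ℝ) => β p.1 p.2.1 p.2.2)
    (hβ_equiv : ∀ γ : Γ, ∀ p : F × F, p ∈ F2 → ∀ b : Fin r → ℝ,
      β (γ • p.1) (γ • p.2) (b + σ γ p.2) = β p.1 p.2 b + σ γ p.1)
    (m : Measure (F × F × (Fin r → ℝ)))
    (hm : m = ((ν₁.prod (ν₂.prod volume)).restrict
        {p : F × F × (Fin r → ℝ) | (p.1, p.2.1) ∈ F2}).withDensity
        fun p => ENNReal.ofReal (Real.exp (ψ₁ (β p.1 p.2.1 p.2.2) + ψ₂ p.2.2))) :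
    (∀ γ : Γ, Measure.map
        (fun p : F × F × (Fin r → ℝ) => (γ • p.1, γ • p.2.1, p.2.2 + σ γ p.2.1)) m = m) ∧
    (∀ L : (Fin r → ℝ) →ₗ[ℝ] (Fin r → ℝ),
      (∀ p : F × F, p ∈ F2 → ∀ b c : Fin r → ℝ, β p.1 p.2 (b + c) = β p.1 p.2 b + L c) →
      ∀ c : Fin r → ℝ,
        Measure.map (fun p : F × F × (Fin r → ℝ) => (p.1, p.2.1, p.2.2 + c)) m =
          ENNReal.ofReal (Real.exp (-(ψ₁ (L c)) - ψ₂ c)) • m) := by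
  have hψ₁ : Measurable ψ₁ := (LinearMap.continuous_of_finiteDimensional ψ₁).measurable
  have hψ₂ : Measurable ψ₂ := (LinearMap.continuous_of_finiteDimensional ψ₂).measurable
  set S : Set (F × F × (Fin r → ℝ)) := {p | (p.1, p.2.1) ∈ F2}
  have hS : MeasurableSet S :=
    hF2_meas.preimage (f := fun p : F × F × (Fin r → ℝ) => (p.1, p.2.1)) (by fun_prop)
  set w : F × F × (Fin r → ℝ) → ENNReal :=
    fun p => ENNReal.ofReal (Real.exp (ψ₁ (β p.1 p.2.1 p.2.2) + ψ₂ p.2.2)) with hw_def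
  have hw : Measurable w := by fun_prop
  have hwS : Measurable (S.indicator w) := hw.indicator hS
  rw [← withDensity_indicator hS] at hm
  refine ⟨fun γ => ?_, fun L hL c => ?_⟩
  · have hσ_inv : ∀ ξ, σ γ⁻¹ (γ • ξ) = -σ γ ξ := fun ξ => by
      have h₁ := hσ_cocycle 1 1 ξ
      have h₂ := hσ_cocycle γ⁻¹ γ ξ
      simp only [one_smul, mul_one, left_eq_add] at h₁
      rw [inv_mul_cancel, h₁] at h₂
      exact eq_neg_of_add_eq_zero_left h₂.symm
    have hσγ := hσ_meas γ
    have hσγ' := hσ_meas γ⁻¹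
    have hγ := hact γ
    have hF2_iff : ∀ ξ η, (γ • ξ, γ • η) ∈ F2 ↔ (ξ, η) ∈ F2 := fun ξ η =>
      ⟨fun h => by simpa using hF2_inv γ⁻¹ _ h, fun h => hF2_inv γ _ h⟩
    rw [hm, Measure.map_withDensity_of_eq_comp (by fun_prop) (by fun_prop)
      (K := fun p => ENNReal.ofReal (Real.exp (ψ₁ (σ γ⁻¹ p.1))) *
        ENNReal.ofReal (Real.exp (ψ₂ (σ γ⁻¹ p.2.1))) * S.indicator w p) (by fun_prop)
      (Measure.map_prod_prod_add_eq_withDensity hγ hγ hσγ (by fun_prop) (by fun_prop)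
        (hconf₁ γ) (hconf₂ γ))]
    · congr 1
      ext p
      simp only [Pi.mul_apply]
      rw [← mul_assoc, mul_mul_mul_comm, ← ENNReal.ofReal_mul (by positivity),
        ← ENNReal.ofReal_mul (by positivity), ← Real.exp_add, ← Real.exp_add]
      simp
    · rintro ⟨ξ, η, b⟩
      by_cases h : (ξ, η) ∈ F2
      · have h' := (hF2_iff ξ η).2 h
        rw [Set.indicator_of_mem (show (ξ, η, b) ∈ S from h), Set.indicator_of_mem
          (show (γ • ξ, γ • η, b + σ γ η) ∈ S from h')]
        simp only [hw_def]
        rw [hβ_equiv γ (ξ, η) h b, hσ_inv, hσ_inv, ← ENNReal.ofReal_mul (by positivity),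
          ← ENNReal.ofReal_mul (by positivity), ← Real.exp_add, ← Real.exp_add]
        simp only [map_neg, map_add]
        ring_nf
      · have h' := mt (hF2_iff ξ η).1 h
        rw [Set.indicator_of_notMem (show (ξ, η, b) ∉ S from h), Set.indicator_of_notMem
          (show (γ • ξ, γ • η, b + σ γ η) ∉ S from h'), mul_zero]
  · have hmap := Measure.map_prod_prod_add_eq_withDensity (ν₁ := ν₁) (ν₂ := ν₂)
      (κ := (volume : Measure (Fin r → ℝ))) (f := id) (g := id) (s := fun _ => c)
      (d₁ := 1) (d₂ := 1) measurable_id measurable_id measurable_const measurable_one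
      measurable_one (by simp) (by simp)
    simp only [id_eq] at hmap
    rw [hm, Measure.map_withDensity_of_eq_comp (by fun_prop) (by fun_prop)
      (K := ENNReal.ofReal (Real.exp (-(ψ₁ (L c)) - ψ₂ c)) • S.indicator w)
      (hwS.const_smul _) hmap, ← withDensity_smul _ hwS]
    · congr 1
      ext p
      simp
    · rintro ⟨ξ, η, b⟩
      by_cases h : (ξ, η) ∈ F2
      · rw [Pi.smul_apply, Set.indicator_of_mem (show (ξ, η, b) ∈ S from h),
          Set.indicator_of_mem (show (ξ, η, b + c) ∈ S from h), smul_eq_mul]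
        simp only [hw_def]
        rw [hL (ξ, η) h b c, ← ENNReal.ofReal_mul (by positivity), ← Real.exp_add]
        simp only [map_add]
        ring_nf
      · rw [Pi.smul_apply, Set.indicator_of_notMem (show (ξ, η, b) ∉ S from h),
          Set.indicator_of_notMem (show (ξ, η, b + c) ∉ S from h), smul_zero]
end

section
/- Let E be a finite-dimensional real vector space, C ⊆ E a convex cone, and f : C → ℝ a positively homogeneous function with f(x) ≥ 0 for all x ∈ C, which is strictly concave off rays in the following sense: f(λx + (1−λ)y) > λf(x) + (1−λ)f(y) whenever λ ∈ (0,1) and x, y ∈ C ∖ {0} are such that neither is a positive scalar multiple of the other. Let Θ : E → ℝ be a linear functional with Θ(x) ≥ f(x) for all x ∈ C, and suppose Θ(v) = f(v) > 0 for some v ∈ C. Then Θ(w) > f(w) for every w ∈ C ∖ {0} which is not a positive scalar multiple of v, and Θ(x) > 0 for every x ∈ C ∖ {0}; in particular C ∩ ker Θ ⊆ {0}. -/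
/-- **The limit cone meets the kernel of the tangent form only at the origin.**
If `f : C → ℝ` is nonnegative, positively homogeneous and strictly concave off rays on a convex
cone `C` in a finite-dimensional real vector space, and `Θ` is a linear functional dominating `f`
on `C` with `Θ v = f v > 0` for some `v ∈ C`, then `Θ > f` on `C ∖ {0}` away from the ray of `v`,
`Θ > 0` on `C ∖ {0}`, and `C ∩ ker Θ ⊆ {0}`. -/
theorem cone_kernel_tangent_form
    {E : Type*} [AddCommGroup E] [Module ℝ E] [FiniteDimensional ℝ E]
    (C : Set E)
    (hC_add : ∀ x ∈ C, ∀ y ∈ C, x + y ∈ C)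
    (hC_smul : ∀ t : ℝ, 0 < t → ∀ x ∈ C, t • x ∈ C)
    (f : E → ℝ)
    (hhom : ∀ t : ℝ, 0 < t → ∀ x ∈ C, f (t • x) = t * f x)
    (hnonneg : ∀ x ∈ C, 0 ≤ f x)
    (hstrict : ∀ l : ℝ, 0 < l → l < 1 → ∀ x ∈ C, ∀ y ∈ C, x ≠ 0 → y ≠ 0 →
      (¬ ∃ t : ℝ, 0 < t ∧ y = t • x) → (¬ ∃ t : ℝ, 0 < t ∧ x = t • y) →
      l * f x + (1 - l) * f y < f (l • x + (1 - l) • y))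
    (Θ : E →ₗ[ℝ] ℝ)
    (hdom : ∀ x ∈ C, f x ≤ Θ x)
    (v : E) (hv : v ∈ C) (htan : Θ v = f v) (hpos : 0 < f v) :
    (∀ w ∈ C, w ≠ 0 → (¬ ∃ t : ℝ, 0 < t ∧ w = t • v) → f w < Θ w) ∧
    (∀ x ∈ C, x ≠ 0 → 0 < Θ x) ∧
    C ∩ (LinearMap.ker Θ : Set E) ⊆ {0} := by
  have hv0 : v ≠ 0 := by
    rintro rfl
    simp only [map_zero] at htan
    linarith
  have off_ray : ∀ w ∈ C, w ≠ 0 → (¬ ∃ t : ℝ, 0 < t ∧ w = t • v) → f w < Θ w := by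
    intro w hw hw0 hwv
    have hvw : ¬ ∃ t : ℝ, 0 < t ∧ v = t • w := by
      rintro ⟨t, ht, rfl⟩
      exact hwv ⟨t⁻¹, inv_pos.2 ht, (inv_smul_smul₀ ht.ne' w).symm⟩
    have hconc := hstrict (1 / 2) (by norm_num) (by norm_num) v hv w hw hv0 hw0 hwv hvw
    have hle := hdom _ (hC_add _ (hC_smul (1 / 2) (by norm_num) v hv)
      _ (hC_smul (1 - 1 / 2) (by norm_num) w hw))
    simp only [map_add, map_smul, smul_eq_mul] at hle
    linarith
  have pos : ∀ x ∈ C, x ≠ 0 → 0 < Θ x := by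
    intro x hx hx0
    by_cases hxv : ∃ t : ℝ, 0 < t ∧ x = t • v
    · obtain ⟨t, ht, rfl⟩ := hxv
      rw [map_smul, smul_eq_mul, htan]
      exact mul_pos ht hpos
    · exact (hnonneg x hx).trans_lt (off_ray x hx hx0 hxv)
  refine ⟨off_ray, pos, ?_⟩
  rintro x ⟨hx, hker⟩
  by_contra hx0
  exact (pos x hx hx0).ne' hker
end

section
/- Let E be a finite-dimensional real inner product space, Θ : E → ℝ a nonzero linear functional, and C ⊆ E a convex cone whose closure cl(C) satisfies cl(C) ∩ ker Θ = {0} and cl(C) ∩ (−cl(C)) = {0}. Let v ∈ C be a unit vector with Θ(v) > 0 which is orthogonal to ker Θ. Then there exists θ₀ ∈ (0, π/2) such that ⟨v, x⟩ ≥ cos(θ₀) · ‖x‖ for all x ∈ cl(C). Consequently, for every t > 0 and every w ∈ ker Θ with t·v + √t·w ∈ C, one has ‖w‖² ≤ tan²(θ₀) · t. -/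
open scoped RealInnerProductSpace

/-- If `v` is a unit vector orthogonal to `ker Θ` with `Θ v ≠ 0`, then `Θ = Θ v • ⟪v, ·⟫`. -/
lemma apply_eq_mul_inner_of_orthogonal_ker
    {E : Type*} [NormedAddCommGroup E] [InnerProductSpace ℝ E] (Θ : E →ₗ[ℝ] ℝ) {v : E}
    (hv_unit : ‖v‖ = 1) (hv : Θ v ≠ 0) (hv_perp : ∀ w ∈ LinearMap.ker Θ, ⟪v, w⟫ = 0) (x : E) :
    Θ x = Θ v * ⟪v, x⟫ := by
  have h := hv_perp (x - (Θ x / Θ v) • v) (by simp [hv])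
  rw [inner_sub_right, real_inner_smul_right, real_inner_self_eq_norm_sq, hv_unit] at h
  field_simp at h
  linarith

/-- A linear functional that is positive at some `v ∈ K` is positive at every nonzero vector of
a pointed convex cone `K` meeting its kernel only at `0`. -/
lemma apply_pos_of_mem_pointed_cone {E : Type*} [AddCommGroup E] [Module ℝ E]
    (Θ : E →ₗ[ℝ] ℝ) {K : Set E}
    (hK_add : ∀ x ∈ K, ∀ y ∈ K, x + y ∈ K) (hK_smul : ∀ t : ℝ, 0 < t → ∀ x ∈ K, t • x ∈ K)
    (hker : K ∩ (LinearMap.ker Θ : Set E) ⊆ {0}) (hpointed : K ∩ -K ⊆ {0})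
    {v : E} (hv : v ∈ K) (hv_pos : 0 < Θ v) {x : E} (hx : x ∈ K) (hx0 : x ≠ 0) : 0 < Θ x := by
  by_contra! hle
  rcases hle.eq_or_lt with h0 | hlt
  · exact hx0 (hker ⟨hx, h0⟩)
  · have hs := hK_smul _ (div_pos (neg_pos.2 hlt) hv_pos) v hv
    have hsum : x + (-Θ x / Θ v) • v = 0 :=
      hker ⟨hK_add _ hx _ hs, by simp [hv_pos.ne']⟩
    rw [← neg_eq_of_add_eq_zero_right hsum] at hs
    exact hx0 (hpointed ⟨hx, hs⟩)

/-- A linear functional `⟪v, ·⟫` positive on the nonzero vectors of a closed cone `K` dominates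
a positive multiple of the norm on `K`. -/
lemma exists_mul_norm_le_inner_of_isClosed_cone
    {E : Type*} [NormedAddCommGroup E] [InnerProductSpace ℝ E] [FiniteDimensional ℝ E]
    {K : Set E} (hK : IsClosed K) (hK_smul : ∀ t : ℝ, 0 < t → ∀ x ∈ K, t • x ∈ K)
    {v : E} (hpos : ∀ x ∈ K, x ≠ 0 → 0 < ⟪v, x⟫) :
    ∃ c : ℝ, 0 < c ∧ c < 1 ∧ ∀ x ∈ K, c * ‖x‖ ≤ ⟪v, x⟫ := by
  have hcompact : IsCompact (K ∩ Metric.sphere 0 1) := (isCompact_sphere 0 1).inter_left hK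
  obtain ⟨m, hm, hbound⟩ : ∃ m : ℝ, 0 < m ∧ ∀ x ∈ K ∩ Metric.sphere 0 1, m ≤ ⟪v, x⟫ :=
    hcompact.exists_forall_le' (f := fun x => ⟪v, x⟫) (by fun_prop) fun x hx =>
      hpos x hx.1 (ne_zero_of_mem_unit_sphere ⟨x, hx.2⟩)
  refine ⟨min m (1 / 2), by positivity, (min_le_right _ _).trans_lt (by norm_num), ?_⟩
  intro x hx
  rcases eq_or_ne x 0 with rfl | hx0
  · simp
  have hn : 0 < ‖x‖ := norm_pos_iff.2 hx0
  have h := hbound (‖x‖⁻¹ • x)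
    ⟨hK_smul _ (inv_pos.2 hn) x hx, by simp [norm_smul, hn.ne']⟩
  rw [real_inner_smul_right, inv_mul_eq_div, le_div_iff₀ hn] at h
  exact (mul_le_mul_of_nonneg_right (min_le_left _ _) hn.le).trans h

/-- If `t • v + √t • w` makes angle at most `θ` with the unit vector `v ⟂ w`, then
`‖w‖ ^ 2 ≤ tan θ ^ 2 * t`. -/
lemma norm_sq_le_tan_sq_mul_of_cos_mul_norm_le_inner
    {E : Type*} [NormedAddCommGroup E] [InnerProductSpace ℝ E] {v w : E} {θ t : ℝ}
    (hv_unit : ‖v‖ = 1) (hvw : ⟪v, w⟫ = 0) (hθ : 0 < Real.cos θ) (ht : 0 < t)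
    (h : Real.cos θ * ‖t • v + √t • w‖ ≤ ⟪v, t • v + √t • w⟫) :
    ‖w‖ ^ 2 ≤ Real.tan θ ^ 2 * t := by
  have hinner : ⟪v, t • v + √t • w⟫ = t := by
    simp [inner_add_right, real_inner_smul_right, hv_unit, hvw]
  have hnorm : ‖t • v + √t • w‖ ^ 2 = t ^ 2 + t * ‖w‖ ^ 2 := by
    rw [norm_add_sq_real, real_inner_smul_left, real_inner_smul_right, hvw, norm_smul, norm_smul,
      mul_pow, mul_pow, Real.norm_eq_abs, Real.norm_eq_abs, sq_abs, sq_abs, Real.sq_sqrt ht.le,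
      hv_unit]
    ring
  rw [hinner] at h
  have hsq := pow_le_pow_left₀ (by positivity) h 2
  rw [mul_pow, hnorm] at hsq
  rw [Real.tan_eq_sin_div_cos, div_pow, div_mul_eq_mul_div, le_div_iff₀ (by positivity),
    Real.sin_sq]
  refine le_of_mul_le_mul_left ?_ ht
  linarith

/-- **Bounded angle between a pointed cone transverse to `ker Θ` and the direction `v`.**
Let `Θ` be a nonzero linear functional on a finite-dimensional real inner product space, and `C`
a convex cone whose closure meets `ker Θ` and `−cl(C)` only at `0`. If `v ∈ C` is a unit vector
with `Θ v > 0` orthogonal to `ker Θ`, then there is `θ₀ ∈ (0, π/2)` with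
`⟪v, x⟫ ≥ cos θ₀ · ‖x‖` on `cl(C)`; hence `‖w‖² ≤ tan² θ₀ · t` whenever `t > 0`, `w ∈ ker Θ`
and `t·v + √t·w ∈ C`. -/
theorem cone_bounded_angle
    {E : Type*} [NormedAddCommGroup E] [InnerProductSpace ℝ E] [FiniteDimensional ℝ E]
    (Θ : E →ₗ[ℝ] ℝ) (hΘ : Θ ≠ 0)
    (C : Set E)
    (hC_add : ∀ x ∈ C, ∀ y ∈ C, x + y ∈ C)
    (hC_smul : ∀ t : ℝ, 0 < t → ∀ x ∈ C, t • x ∈ C)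
    (hker : closure C ∩ (LinearMap.ker Θ : Set E) = {0})
    (hpointed : closure C ∩ (-(closure C)) = {0})
    (v : E) (hv : v ∈ C) (hv_unit : ‖v‖ = 1) (hv_pos : 0 < Θ v)
    (hv_perp : ∀ w ∈ LinearMap.ker Θ, ⟪v, w⟫ = 0) :
    ∃ θ₀ : ℝ, 0 < θ₀ ∧ θ₀ < Real.pi / 2 ∧
      (∀ x ∈ closure C, Real.cos θ₀ * ‖x‖ ≤ ⟪v, x⟫) ∧
      (∀ t : ℝ, 0 < t → ∀ w ∈ LinearMap.ker Θ, t • v + Real.sqrt t • w ∈ C →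
        ‖w‖ ^ 2 ≤ Real.tan θ₀ ^ 2 * t) := by
  have hcl_add : ∀ x ∈ closure C, ∀ y ∈ closure C, x + y ∈ closure C := fun x hx y hy =>
    map_mem_closure₂ continuous_add hx hy hC_add
  have hcl_smul : ∀ t : ℝ, 0 < t → ∀ x ∈ closure C, t • x ∈ closure C := fun t ht x hx =>
    map_mem_closure (continuous_const_smul t) hx (hC_smul t ht)
  have hpos : ∀ x ∈ closure C, x ≠ 0 → 0 < ⟪v, x⟫ := fun x hx hx0 => by
    have h := apply_pos_of_mem_pointed_cone Θ hcl_add hcl_smul hker.subset hpointed.subset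
      (subset_closure hv) hv_pos hx hx0
    rw [apply_eq_mul_inner_of_orthogonal_ker Θ hv_unit hv_pos.ne' hv_perp] at h
    exact pos_of_mul_pos_right h hv_pos.le
  obtain ⟨c, hc0, hc1, hc⟩ :=
    exists_mul_norm_le_inner_of_isClosed_cone isClosed_closure hcl_smul hpos
  have hcos : Real.cos (Real.arccos c) = c := Real.cos_arccos (by linarith) hc1.le
  refine ⟨Real.arccos c, Real.arccos_pos.2 hc1, Real.arccos_lt_pi_div_two.2 hc0,
    by rwa [hcos], fun t ht w hw hmem => ?_⟩
  exact norm_sq_le_tan_sq_mul_of_cos_mul_norm_le_inner hv_unit (hv_perp w hw) (by rwa [hcos]) ht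
    (by rw [hcos]; exact hc _ (subset_closure hmem))
end

section
/- For M > 0 set c(M) := (1 − (1 + 4M)^{−1/2})/2. Then 0 < c(M) < 1/2, and for all real numbers a ≥ 0 and T > 0 with T² ≥ M·a², one has (−a + √(a² + 4T²))/2 − T ≤ −c(M)·a. -/
/-- **Endpoint estimate.** For `M > 0` set `c(M) = (1 − (1 + 4M)^{−1/2})/2`. Then
`0 < c(M) < 1/2`, and for all `a ≥ 0` and `T > 0` with `T² ≥ M·a²`, one has
`(−a + √(a² + 4T²))/2 − T ≤ −c(M)·a`. -/
theorem endpoint_estimate (M : ℝ) (hM : 0 < M)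
    (c : ℝ) (hc : c = (1 - (1 + 4 * M) ^ (-(1 / 2) : ℝ)) / 2) :
    (0 < c ∧ c < 1 / 2) ∧
    ∀ a T : ℝ, 0 ≤ a → 0 < T → M * a ^ 2 ≤ T ^ 2 →
      (-a + Real.sqrt (a ^ 2 + 4 * T ^ 2)) / 2 - T ≤ -(c * a) := by
  have hone : 1 < 1 + 4 * M := by linarith
  have hpos : 0 < 1 + 4 * M := by linarith
  rw [Real.rpow_neg hpos.le, ← Real.sqrt_eq_rpow] at hc
  set s := Real.sqrt (1 + 4 * M) with hs
  have hs1 : 1 < s := by rw [hs]; exact Real.lt_sqrt_of_sq_lt (by simpa using hone)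
  have hs0 : 0 < s := by linarith
  have hr0 : 0 < s⁻¹ := inv_pos.mpr hs0
  have hr1 : s⁻¹ < 1 := inv_lt_one_of_one_lt₀ hs1
  refine ⟨⟨by linarith, by linarith⟩, fun a T ha hT hMT => ?_⟩
  set R := Real.sqrt (a ^ 2 + 4 * T ^ 2) with hR
  have hR2 : R ^ 2 = a ^ 2 + 4 * T ^ 2 := Real.sq_sqrt (by positivity)
  have hR0 : 0 ≤ R := Real.sqrt_nonneg _
  have hs2 : s ^ 2 = 1 + 4 * M := Real.sq_sqrt hpos.le
  have hasR : a * s ≤ R := by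
    refine Real.le_sqrt_of_sq_le ?_
    rw [mul_pow, hs2]
    linarith
  have hkey : R - 2 * T ≤ a * s⁻¹ := by
    by_contra! h
    have h1 : a * s⁻¹ * (R + 2 * T) < (R - 2 * T) * (R + 2 * T) :=
      mul_lt_mul_of_pos_right h (by linarith)
    have h2 : a * s⁻¹ * (a * s) ≤ a * s⁻¹ * (R + 2 * T) :=
      mul_le_mul_of_nonneg_left (by linarith) (by positivity)
    have h3 : a * s⁻¹ * (a * s) = a ^ 2 := by field_simp
    linarith
  rw [hc]
  linarith
end

section
/- Let δ > 0 and M > 0, and set c := (1 − (1 + 4M)^{−1/2})/2. Then for all real numbers a ≥ 0, T > 0 and α ≥ 0 with T² ≥ M·a² and α ≤ S := (−a + √(a² + 4T²))/2, one has e^{−δT} · ∫_α^S e^{δt} dt ≤ δ^{−1} · e^{−c·δ·a}. -/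
/-- If `r * a ≤ √(a² + 4T²)`, then `√(a² + 4T²)` exceeds `2T` by at most `a / r`. -/
theorem sqrt_sq_add_sub_le_div {a T r : ℝ} (ha : 0 ≤ a) (hT : 0 < T) (hr : 0 < r)
    (h : r * a ≤ Real.sqrt (a ^ 2 + 4 * T ^ 2)) :
    Real.sqrt (a ^ 2 + 4 * T ^ 2) - 2 * T ≤ a / r := by
  have hw : Real.sqrt (a ^ 2 + 4 * T ^ 2) ^ 2 = a ^ 2 + 4 * T ^ 2 :=
    Real.sq_sqrt (by positivity)
  set w := Real.sqrt (a ^ 2 + 4 * T ^ 2) with hw_def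
  have hw0 : 0 ≤ w := Real.sqrt_nonneg _
  rw [le_div_iff₀ hr]
  by_contra! hlt
  have h1 : a * (w + 2 * T) < (w - 2 * T) * r * (w + 2 * T) :=
    mul_lt_mul_of_pos_right hlt (by linarith)
  have h2 : (w - 2 * T) * r * (w + 2 * T) = r * a * a := by linear_combination r * hw
  have h3 : r * a * a ≤ w * a := mul_le_mul_of_nonneg_right h ha
  have h4 : 0 ≤ a * T := by positivity
  linarith

theorem integral_exp_const_mul {δ : ℝ} (hδ : δ ≠ 0) (α β : ℝ) :
    ∫ t in α..β, Real.exp (δ * t) = δ⁻¹ * (Real.exp (δ * β) - Real.exp (δ * α)) := by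
  rw [intervalIntegral.integral_comp_mul_left (fun x => Real.exp x) hδ, integral_exp,
    smul_eq_mul]

/-- **Uniform exponential-integral upper bound.** For `δ, M > 0` and
`c = (1 − (1 + 4M)^{−1/2})/2`, for all `a ≥ 0`, `T > 0`, `0 ≤ α` with `T² ≥ M·a²` and
`α ≤ S = (−a + √(a² + 4T²))/2`, one has `e^{−δT} ∫_α^S e^{δt} dt ≤ δ⁻¹ e^{−cδa}`. -/
theorem exp_integral_upper_bound (δ M : ℝ) (hδ : 0 < δ) (hM : 0 < M)
    (c : ℝ) (hc : c = (1 - (1 + 4 * M) ^ (-(1 / 2) : ℝ)) / 2) :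
    ∀ a T α : ℝ, 0 ≤ a → 0 < T → 0 ≤ α → M * a ^ 2 ≤ T ^ 2 →
      α ≤ (-a + Real.sqrt (a ^ 2 + 4 * T ^ 2)) / 2 →
      Real.exp (-δ * T) *
          ∫ t in α..((-a + Real.sqrt (a ^ 2 + 4 * T ^ 2)) / 2), Real.exp (δ * t) ≤
        δ⁻¹ * Real.exp (-c * δ * a) := by
  intro a T α ha hT _ hMT _
  have hr : 0 < Real.sqrt (1 + 4 * M) := Real.sqrt_pos.2 (by linarith)
  have hrw : Real.sqrt (1 + 4 * M) * a ≤ Real.sqrt (a ^ 2 + 4 * T ^ 2) := by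
    apply Real.le_sqrt_of_sq_le
    rw [mul_pow, Real.sq_sqrt (by linarith)]
    linarith
  have hc' : c = (1 - (Real.sqrt (1 + 4 * M))⁻¹) / 2 := by
    rw [hc, Real.rpow_neg (by linarith), Real.sqrt_eq_rpow]
  have key := sqrt_sq_add_sub_le_div ha hT hr hrw
  rw [div_eq_mul_inv] at key
  have hS : (-a + Real.sqrt (a ^ 2 + 4 * T ^ 2)) / 2 - T ≤ -c * a := by
    rw [hc']
    linarith
  rw [integral_exp_const_mul hδ.ne', mul_left_comm]
  refine mul_le_mul_of_nonneg_left ?_ (inv_nonneg.2 hδ.le)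
  calc
    _ ≤ Real.exp (-δ * T) * Real.exp (δ * ((-a + Real.sqrt (a ^ 2 + 4 * T ^ 2)) / 2)) :=
      mul_le_mul_of_nonneg_left (sub_le_self _ (Real.exp_pos _).le) (Real.exp_pos _).le
    _ ≤ _ := by
      rw [← Real.exp_add, Real.exp_le_exp]
      linarith [mul_le_mul_of_nonneg_left hS hδ.le]
end

section
/- For all real numbers δ > 0, k ≥ 0, α > 0 and a ≥ 0, one has lim_{T→∞} e^{−δT} · T^k · ∫_α^{(−a+√(a²+4T²))/2} t^{−k} · e^{δt} dt = δ^{−1} · e^{−δ·a/2}. (For all sufficiently large T the upper limit of integration exceeds α, so the integral is eventually over a nonempty interval.) -/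
open Filter MeasureTheory Set Topology

theorem integrableOn_one_add_div_rpow_mul_exp_neg {δ α : ℝ} (k : ℝ) (hδ : 0 < δ) (hα : 0 < α) :
    IntegrableOn (fun s : ℝ => (1 + s / α) ^ k * Real.exp (-δ * s)) (Ioi 0) := by
  refine integrable_of_isBigO_exp_neg (b := δ / 2) (by positivity) ?_ ?_
  · refine ContinuousOn.mul (ContinuousOn.rpow_const (by fun_prop) fun s hs => Or.inl ?_)
      (by fun_prop)
    have : 0 ≤ s / α := div_nonneg hs hα.le
    positivity
  · have hlin : Tendsto (fun s : ℝ => 1 + s / α) atTop atTop :=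
      tendsto_atTop_add_const_left _ _ (tendsto_id.atTop_div_const hα)
    have h := (isLittleO_rpow_exp_pos_mul_atTop k (b := α * δ / 2) (by positivity)).comp_tendsto hlin
    have h' : (fun s : ℝ => (1 + s / α) ^ k) =O[atTop] fun s => Real.exp (δ / 2 * s) := by
      refine h.isBigO.trans (Asymptotics.IsBigO.of_bound (Real.exp (α * δ / 2)) ?_)
      refine Eventually.of_forall fun s => le_of_eq ?_
      simp only [Function.comp_apply, Real.norm_eq_abs, Real.abs_exp, ← Real.exp_add]
      congr 1
      field_simp
    refine (h'.mul (Asymptotics.isBigO_refl (fun s : ℝ => Real.exp (-δ * s)) atTop)).congr_right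
      fun s => ?_
    rw [← Real.exp_add]
    congr 1
    ring

theorem exp_mul_rpow_mul_integral_eq {δ k α x : ℝ} (hα : 0 < α) (hx : α ≤ x) :
    Real.exp (-δ * x) * x ^ k * ∫ t in α..x, t ^ (-k) * Real.exp (δ * t) =
      ∫ s in Ioi 0, (Ioc 0 (x - α)).indicator
        (fun s => (x / (x - s)) ^ k * Real.exp (-δ * s)) s := by
  have hsub := intervalIntegral.integral_comp_sub_left (a := 0) (b := x - α)
    (fun t : ℝ => t ^ (-k) * Real.exp (δ * t)) x
  rw [sub_sub_cancel, sub_zero] at hsub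
  rw [← hsub, ← intervalIntegral.integral_const_mul,
    intervalIntegral.integral_of_le (sub_nonneg.2 hx), setIntegral_indicator measurableSet_Ioc,
    inter_eq_self_of_subset_right Ioc_subset_Ioi_self]
  refine setIntegral_congr_fun measurableSet_Ioc fun s hs => ?_
  have hxs : 0 < x - s := by linarith [hs.2]
  have hexp : Real.exp (-δ * s) = Real.exp (-δ * x) * Real.exp (δ * (x - s)) := by
    rw [← Real.exp_add]
    congr 1
    ring
  rw [Real.div_rpow (hα.le.trans hx) hxs.le, Real.rpow_neg hxs.le, hexp]
  ring

theorem tendsto_exp_mul_rpow_mul_integral {δ k α : ℝ} (hδ : 0 < δ) (hk : 0 ≤ k) (hα : 0 < α) :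
    Tendsto (fun x : ℝ => Real.exp (-δ * x) * x ^ k *
      ∫ t in α..x, t ^ (-k) * Real.exp (δ * t)) atTop (𝓝 δ⁻¹) := by
  have hval : ∫ s in Ioi (0 : ℝ), Real.exp (-δ * s) = δ⁻¹ := by
    rw [integral_exp_mul_Ioi (by linarith)]
    simp
  rw [← hval]
  refine Tendsto.congr' (f₁ := fun x : ℝ => ∫ s in Ioi 0, (Ioc 0 (x - α)).indicator
        (fun s => (x / (x - s)) ^ k * Real.exp (-δ * s)) s) ?_ ?_
  · filter_upwards [eventually_ge_atTop α] with x hx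
    exact (exp_mul_rpow_mul_integral_eq hα hx).symm
  refine tendsto_integral_filter_of_dominated_convergence _ ?_ ?_
    (integrableOn_one_add_div_rpow_mul_exp_neg k hδ hα) ?_
  · refine Eventually.of_forall fun x => ?_
    exact (Measurable.indicator (by fun_prop) measurableSet_Ioc).aestronglyMeasurable
  · filter_upwards [eventually_ge_atTop α] with x hx
    filter_upwards [ae_restrict_mem measurableSet_Ioi] with s hs
    have hs0 : 0 < s := hs
    by_cases hmem : s ∈ Ioc 0 (x - α)
    · have hαxs : α ≤ x - s := by linarith [hmem.2]
      have hxs : 0 < x - s := hα.trans_le hαxs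
      have hx0 : 0 < x := hα.trans_le hx
      rw [indicator_of_mem hmem, Real.norm_of_nonneg (by positivity)]
      gcongr
      calc x / (x - s) = 1 + s / (x - s) := by field_simp; ring
        _ ≤ 1 + s / α := by gcongr
    · rw [indicator_of_notMem hmem, norm_zero]
      positivity
  · filter_upwards [ae_restrict_mem measurableSet_Ioi] with s hs
    have hs0 : 0 < s := hs
    have hratio : Tendsto (fun x : ℝ => 1 + s / (x - s)) atTop (𝓝 (1 + 0)) :=
      tendsto_const_nhds.add (tendsto_const_nhds.div_atTop
        (tendsto_atTop_add_const_right _ _ tendsto_id))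
    rw [add_zero] at hratio
    have hpow := (hratio.rpow_const (p := k) (Or.inl one_ne_zero)).mul_const (Real.exp (-δ * s))
    rw [Real.one_rpow, one_mul] at hpow
    refine hpow.congr' ?_
    filter_upwards [eventually_ge_atTop (s + α)] with x hx
    have hxs : x - s ≠ 0 := by linarith
    have hmem : s ∈ Ioc 0 (x - α) := ⟨hs0, by linarith⟩
    rw [indicator_of_mem hmem]
    congr 2
    field_simp
    ring

theorem tendsto_neg_add_sqrt_half_sub (a : ℝ) :
    Tendsto (fun T : ℝ => (-a + Real.sqrt (a ^ 2 + 4 * T ^ 2)) / 2 - T) atTop (𝓝 (-a / 2)) := by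
  have hupper : Tendsto (fun T : ℝ => -a / 2 + a ^ 2 / 8 / T) atTop (𝓝 (-a / 2 + 0)) :=
    tendsto_const_nhds.add (tendsto_const_nhds.div_atTop tendsto_id)
  rw [add_zero] at hupper
  refine tendsto_of_tendsto_of_tendsto_of_le_of_le' tendsto_const_nhds hupper ?_ ?_
  · filter_upwards with T
    have : 2 * T ≤ Real.sqrt (a ^ 2 + 4 * T ^ 2) :=
      Real.le_sqrt_of_sq_le (by nlinarith [sq_nonneg a])
    linarith
  · filter_upwards [eventually_gt_atTop 0] with T hT
    have : Real.sqrt (a ^ 2 + 4 * T ^ 2) ≤ 2 * T + 2 * (a ^ 2 / 8 / T) := by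
      rw [Real.sqrt_le_left (by positivity)]
      have h : (2 * T + 2 * (a ^ 2 / 8 / T)) ^ 2 =
          a ^ 2 + 4 * T ^ 2 + (2 * (a ^ 2 / 8 / T)) ^ 2 := by
        field_simp
        ring
      rw [h]
      exact le_add_of_nonneg_right (sq_nonneg _)
    linarith

/-- **Dominated-convergence limit of the exponential integral.** For `δ > 0`, `k ≥ 0`,
`α > 0` and `a ≥ 0`,
`lim_{T→∞} e^{−δT} T^k ∫_α^{(−a+√(a²+4T²))/2} t^{−k} e^{δt} dt = δ⁻¹ e^{−δa/2}`. -/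
theorem exp_integral_limit (δ k α a : ℝ) (hδ : 0 < δ) (hk : 0 ≤ k) (hα : 0 < α) (ha : 0 ≤ a) :
    Filter.Tendsto
      (fun T : ℝ => Real.exp (-δ * T) * T ^ k *
        ∫ t in α..((-a + Real.sqrt (a ^ 2 + 4 * T ^ 2)) / 2), t ^ (-k) * Real.exp (δ * t))
      Filter.atTop (nhds (δ⁻¹ * Real.exp (-δ * a / 2))) := by
  set U : ℝ → ℝ := fun T => (-a + Real.sqrt (a ^ 2 + 4 * T ^ 2)) / 2
  have hdiff : Tendsto (fun T => U T - T) atTop (𝓝 (-a / 2)) := tendsto_neg_add_sqrt_half_sub a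
  have hUtop : Tendsto U atTop atTop :=
    (hdiff.add_atTop tendsto_id).congr fun T => sub_add_cancel _ _
  have hratio : Tendsto (fun T => 1 - (U T - T) / U T) atTop (𝓝 (1 - 0)) :=
    tendsto_const_nhds.sub (hdiff.div_atTop hUtop)
  rw [sub_zero] at hratio
  have hpow := hratio.rpow_const (p := k) (Or.inl one_ne_zero)
  rw [Real.one_rpow] at hpow
  have hexp : Tendsto (fun T => Real.exp (δ * (U T - T))) atTop (𝓝 (Real.exp (-δ * a / 2))) := by
    have := (Real.continuous_exp.tendsto _).comp (hdiff.const_mul δ)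
    rwa [show δ * (-a / 2) = -δ * a / 2 by ring] at this
  have hmain := (((tendsto_exp_mul_rpow_mul_integral hδ hk hα).comp hUtop).mul hexp).mul hpow
  rw [mul_one] at hmain
  refine hmain.congr' ?_
  filter_upwards [hUtop.eventually_gt_atTop 0, eventually_gt_atTop 0] with T hUT hT
  have h1 : 1 - (U T - T) / U T = T / U T := by
    field_simp
    ring
  have h2 : Real.exp (-δ * T) = Real.exp (-δ * U T) * Real.exp (δ * (U T - T)) := by
    rw [← Real.exp_add]
    congr 1
    ring
  have h3 : U T ^ k ≠ 0 := (Real.rpow_pos_of_pos hUT k).ne'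
  change _ = Real.exp (-δ * T) * T ^ k * ∫ t in α..U T, t ^ (-k) * Real.exp (δ * t)
  rw [h1, h2, Real.div_rpow hT.le hUT.le, Function.comp_apply]
  field_simp
end

section
/- Let E be a finite-dimensional real inner product space, C ⊆ E a closed convex cone, v ∈ C a unit vector, and w ∈ E with ⟨v, w⟩ = 0. Then: (i) ‖t·v + √t·w‖² = t² + t·‖w‖² for every t ≥ 0; (ii) the set S := {t > 0 : t·v + √t·w ∈ C} is upward closed, i.e. if s ∈ S and t ≥ s then t ∈ S; (iii) for every T > 0, if S is nonempty then {t > 0 : t·v + √t·w ∈ C and ‖t·v + √t·w‖ ≤ T} = {t > 0 : t_w ≤ t ≤ (−‖w‖² + √(‖w‖⁴ + 4T²))/2}, where t_w := inf S; in particular this set is an interval. -/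
open scoped RealInnerProductSpace

lemma norm_sq_smul_add_sqrt_smul {E : Type*} [NormedAddCommGroup E] [InnerProductSpace ℝ E]
    {v w : E} (hv : ‖v‖ = 1) (hw : ⟪v, w⟫ = 0) {t : ℝ} (ht : 0 ≤ t) :
    ‖t • v + √t • w‖ ^ 2 = t ^ 2 + t * ‖w‖ ^ 2 := by
  rw [norm_add_sq_real, real_inner_smul_left, real_inner_smul_right, hw, norm_smul, norm_smul,
    mul_pow, mul_pow, hv, Real.norm_eq_abs, Real.norm_eq_abs, sq_abs, sq_abs, Real.sq_sqrt ht]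
  ring

lemma smul_add_sqrt_smul_mem_of_le {E : Type*} [AddCommGroup E] [Module ℝ E] {C : Set E}
    (hadd : ∀ x ∈ C, ∀ y ∈ C, x + y ∈ C) (hsmul : ∀ t : ℝ, 0 < t → ∀ x ∈ C, t • x ∈ C)
    {v w : E} (hv : v ∈ C) {s t : ℝ} (hs : 0 < s) (hst : s ≤ t)
    (hmem : s • v + √s • w ∈ C) : t • v + √t • w ∈ C := by
  obtain rfl | hlt := hst.eq_or_lt
  · exact hmem
  have hs' : 0 < √s := Real.sqrt_pos.2 hs
  have hst' : √s < √t := Real.sqrt_lt_sqrt hs.le hlt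
  have hcs : √t / √s * s = √t * √s := by
    nth_rewrite 2 [← Real.mul_self_sqrt hs.le]
    field_simp
  have hpos : 0 < t - √t * √s := by
    nlinarith [Real.mul_self_sqrt (hs.trans hlt).le]
  have key : t • v + √t • w = (√t / √s) • (s • v + √s • w) + (t - √t * √s) • v := by
    rw [smul_add, smul_smul, smul_smul, hcs, div_mul_cancel₀ _ hs'.ne', sub_smul]
    abel
  rw [key]
  exact hadd _ (hsmul _ (div_pos (hs'.trans hst') hs') _ hmem) _ (hsmul _ hpos _ hv)

lemma sq_add_mul_sq_le_sq_iff {t : ℝ} (ht : 0 ≤ t) (a T : ℝ) :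
    t ^ 2 + t * a ^ 2 ≤ T ^ 2 ↔ t ≤ (-a ^ 2 + √(a ^ 4 + 4 * T ^ 2)) / 2 := by
  have h : t ≤ (-a ^ 2 + √(a ^ 4 + 4 * T ^ 2)) / 2 ↔ 2 * t + a ^ 2 ≤ √(a ^ 4 + 4 * T ^ 2) := by
    constructor <;> intro h <;> linarith
  rw [h, Real.le_sqrt (by positivity) (by positivity)]
  constructor <;> intro h <;> nlinarith

/-- **The set `R_T(w)` is an interval.** Let `C` be a closed convex cone in a finite-dimensional
real inner product space, `v ∈ C` a unit vector and `w ⊥ v`. Then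
(i) `‖t·v + √t·w‖² = t² + t‖w‖²` for `t ≥ 0`;
(ii) `S = {t > 0 : t·v + √t·w ∈ C}` is upward closed;
(iii) for `T > 0`, if `S ≠ ∅` then
`{t > 0 : t·v + √t·w ∈ C, ‖t·v + √t·w‖ ≤ T} = {t > 0 : inf S ≤ t ≤ (−‖w‖² + √(‖w‖⁴+4T²))/2}`. -/
theorem time_interval_structure
    {E : Type*} [NormedAddCommGroup E] [InnerProductSpace ℝ E] [FiniteDimensional ℝ E]
    (C : Set E) (hC_closed : IsClosed C)
    (hC_add : ∀ x ∈ C, ∀ y ∈ C, x + y ∈ C)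
    (hC_smul : ∀ t : ℝ, 0 < t → ∀ x ∈ C, t • x ∈ C)
    (v : E) (hv : v ∈ C) (hv_unit : ‖v‖ = 1)
    (w : E) (hw : ⟪v, w⟫ = 0)
    (S : Set ℝ) (hS : S = {t : ℝ | 0 < t ∧ t • v + Real.sqrt t • w ∈ C}) :
    (∀ t : ℝ, 0 ≤ t → ‖t • v + Real.sqrt t • w‖ ^ 2 = t ^ 2 + t * ‖w‖ ^ 2) ∧
    (∀ s ∈ S, ∀ t : ℝ, s ≤ t → t ∈ S) ∧
    (∀ T : ℝ, 0 < T → S.Nonempty →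
      {t : ℝ | 0 < t ∧ t • v + Real.sqrt t • w ∈ C ∧ ‖t • v + Real.sqrt t • w‖ ≤ T} =
        {t : ℝ | 0 < t ∧ sInf S ≤ t ∧
          t ≤ (-‖w‖ ^ 2 + Real.sqrt (‖w‖ ^ 4 + 4 * T ^ 2)) / 2}) := by
  subst hS
  have hup : ∀ s ∈ {t : ℝ | 0 < t ∧ t • v + √t • w ∈ C}, ∀ t : ℝ, s ≤ t →
      t ∈ {t : ℝ | 0 < t ∧ t • v + √t • w ∈ C} := fun s hs t hst =>
    ⟨hs.1.trans_le hst, smul_add_sqrt_smul_mem_of_le hC_add hC_smul hv hs.1 hst hs.2⟩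
  refine ⟨fun t ht => norm_sq_smul_add_sqrt_smul hv_unit hw ht, hup, fun T hT hne => ?_⟩
  have hbdd : BddBelow {t : ℝ | 0 < t ∧ t • v + √t • w ∈ C} := ⟨0, fun t ht => ht.1.le⟩
  have hclosed : IsClosed {t : ℝ | t • v + √t • w ∈ C} :=
    hC_closed.preimage (f := fun t : ℝ => t • v + √t • w) (by fun_prop)
  have hinf : sInf {t : ℝ | 0 < t ∧ t • v + √t • w ∈ C} ∈ {t : ℝ | t • v + √t • w ∈ C} :=
    closure_minimal (fun _ ht => ht.2) hclosed (csInf_mem_closure hne hbdd)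
  ext t
  refine and_congr_right fun ht => and_congr ⟨fun h => csInf_le hbdd ⟨ht, h⟩, fun h => ?_⟩ ?_
  · obtain heq | hlt := h.eq_or_lt
    · rwa [heq] at hinf
    · obtain ⟨s, hs, hst⟩ := exists_lt_of_csInf_lt hne hlt
      exact (hup s hs t hst.le).2
  · rw [← sq_add_mul_sq_le_sq_iff ht.le, ← norm_sq_smul_add_sqrt_smul hv_unit hw ht.le,
      sq_le_sq₀ (norm_nonneg _) hT.le]
end

section
/- Let E be an n-dimensional real inner product space with n ≥ 1, equipped with the Lebesgue (Haar) measure for which a cube spanned by an orthonormal basis has volume 1. Let v ∈ E be a unit vector and let W := {w ∈ E : ⟨v, w⟩ = 0}, equipped with its own such Lebesgue measure as an inner product space. Then the map Φ(t, w) := t·v + √t·w is a bijection from (0, ∞) × W onto the open half-space {x ∈ E : ⟨v, x⟩ > 0}, and for every nonnegative measurable function f : E → ℝ, ∫_{{x ∈ E : ⟨v, x⟩ > 0}} f(x) dx = ∫_W ∫_0^∞ f(t·v + √t·w) · t^{(n−1)/2} dt dw. -/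
open MeasureTheory
open scoped RealInnerProductSpace

/-- For a unit vector `v`, the map `(t, w) ↦ t • v + w` identifies `ℝ × (ℝ ∙ v)ᗮ` with the ambient
space in a volume-preserving way. -/
theorem measurePreserving_smul_add_orthogonal
    {E : Type*} [NormedAddCommGroup E] [InnerProductSpace ℝ E] [FiniteDimensional ℝ E]
    [MeasurableSpace E] [BorelSpace E] {v : E} (hv : ‖v‖ = 1) :
    MeasurePreserving (fun p : ℝ × ↥((ℝ ∙ v)ᗮ) => p.1 • v + (p.2 : E)) := by
  have h := ((LinearIsometryEquiv.measurePreserving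
    (LinearIsometryEquiv.toSpanUnitSingleton (𝕜 := ℝ) v hv)).prod
      (MeasurePreserving.id (volume : Measure ↥((ℝ ∙ v)ᗮ))))
  have h' := ((ℝ ∙ v).orthogonalDecomposition.symm.measurePreserving.comp
    (WithLp.volume_preserving_toLp (ℝ ∙ v) (ℝ ∙ v)ᗮ)).comp h
  rw [Measure.volume_eq_prod]
  convert h' using 1
  ext p
  change _ = (ℝ ∙ v).orthogonalDecomposition.symm.toLinearEquiv _
  rw [Submodule.toLinearEquiv_orthogonalDecomposition_symm]
  simp

/-- Scaling by `r > 0` in a finite-dimensional space multiplies Lebesgue integrals by the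
appropriate power of `r`. -/
theorem lintegral_eq_pow_mul_lintegral_smul
    {W : Type*} [NormedAddCommGroup W] [NormedSpace ℝ W] [FiniteDimensional ℝ W]
    [MeasurableSpace W] [BorelSpace W] (μ : Measure W) [μ.IsAddHaarMeasure]
    {F : W → ENNReal} (hF : Measurable F) {r : ℝ} (hr : 0 < r) :
    ∫⁻ w, F w ∂μ = ENNReal.ofReal (r ^ Module.finrank ℝ W) * ∫⁻ w, F (r • w) ∂μ := by
  rw [← lintegral_map (f := F) hF (measurable_const_smul r),
    Measure.map_addHaar_smul μ hr.ne', lintegral_smul_measure, smul_eq_mul, ← mul_assoc,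
    ← ENNReal.ofReal_mul (by positivity), abs_of_pos (by positivity),
    mul_inv_cancel₀ (by positivity), ENNReal.ofReal_one, one_mul]

theorem inner_smul_add_orthogonal
    {E : Type*} [NormedAddCommGroup E] [InnerProductSpace ℝ E] {v : E} (hv : ‖v‖ = 1)
    (t : ℝ) {w : E} (hw : w ∈ (ℝ ∙ v)ᗮ) : ⟪v, t • v + w⟫ = t := by
  rw [inner_add_right, real_inner_smul_right, real_inner_self_eq_norm_sq, hv,
    Submodule.mem_orthogonal_singleton_iff_inner_right.1 hw]
  ring

theorem bijOn_smul_add_sqrt_smul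
    {E : Type*} [NormedAddCommGroup E] [InnerProductSpace ℝ E] {v : E} (hv : ‖v‖ = 1) :
    Set.BijOn (fun p : ℝ × ↥((ℝ ∙ v)ᗮ) => p.1 • v + Real.sqrt p.1 • (p.2 : E))
      (Set.Ioi (0 : ℝ) ×ˢ Set.univ) {x : E | 0 < ⟪v, x⟫} := by
  have hinner (p : ℝ × ↥((ℝ ∙ v)ᗮ)) : ⟪v, p.1 • v + Real.sqrt p.1 • (p.2 : E)⟫ = p.1 :=
    inner_smul_add_orthogonal hv _ (Submodule.smul_mem _ _ p.2.2)
  refine ⟨fun p hp => ?_, fun p hp q _ hpq => ?_, fun x hx => ?_⟩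
  · exact (Set.mem_Ioi.1 hp.1).trans_eq (hinner p).symm
  · have ht : p.1 = q.1 := by
      rw [← hinner p, ← hinner q]
      exact congrArg _ hpq
    refine Prod.ext ht (Subtype.ext ?_)
    simp only [← ht] at hpq
    exact smul_right_injective E (Real.sqrt_pos.2 hp.1).ne' (add_left_cancel hpq)
  · have hx' : 0 < ⟪v, x⟫ := hx
    refine ⟨(⟪v, x⟫, ⟨(Real.sqrt ⟪v, x⟫)⁻¹ • (x - ⟪v, x⟫ • v), ?_⟩), ⟨hx, trivial⟩, ?_⟩
    · refine Submodule.smul_mem _ _ (Submodule.mem_orthogonal_singleton_iff_inner_right.2 ?_)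
      rw [inner_sub_right, real_inner_smul_right, real_inner_self_eq_norm_sq, hv]
      ring
    · simp [smul_inv_smul₀ (Real.sqrt_pos.2 hx').ne']

/-- **Change of variables `b = t·v + √t·w`.** Let `E` be an `n`-dimensional real inner product
space (`n ≥ 1`) with its canonical Lebesgue measure (orthonormal cubes have volume `1`), `v` a
unit vector and `W = {w : ⟪v, w⟫ = 0}` with its own canonical Lebesgue measure. Then
`Φ(t, w) = t·v + √t·w` is a bijection from `(0,∞) × W` onto the open half-space
`{x : ⟪v, x⟫ > 0}` and for every nonnegative measurable `f`,
`∫_{⟪v,x⟫>0} f = ∫_W ∫_0^∞ f(t·v + √t·w) t^{(n−1)/2} dt dw`. -/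
theorem halfspace_change_of_variables
    {E : Type*} [NormedAddCommGroup E] [InnerProductSpace ℝ E] [FiniteDimensional ℝ E]
    [MeasurableSpace E] [BorelSpace E]
    (n : ℕ) (hn : 1 ≤ n) (hdim : Module.finrank ℝ E = n)
    (v : E) (hv : ‖v‖ = 1) :
    Set.BijOn (fun p : ℝ × ↥((ℝ ∙ v)ᗮ) => p.1 • v + Real.sqrt p.1 • (p.2 : E))
      (Set.Ioi (0 : ℝ) ×ˢ Set.univ) {x : E | 0 < ⟪v, x⟫} ∧
    ∀ f : E → ℝ, Measurable f → (∀ x, 0 ≤ f x) →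
      ∫⁻ x in {x : E | 0 < ⟪v, x⟫}, ENNReal.ofReal (f x) =
        ∫⁻ w : ↥((ℝ ∙ v)ᗮ), ∫⁻ t in Set.Ioi (0 : ℝ),
          ENNReal.ofReal (f (t • v + Real.sqrt t • (w : E)) * t ^ (((n : ℝ) - 1) / 2)) := by
  refine ⟨bijOn_smul_add_sqrt_smul hv, fun f hf hf0 => ?_⟩
  have hrank : Module.finrank ℝ ↥((ℝ ∙ v)ᗮ) = n - 1 := by
    have h := (ℝ ∙ v).finrank_add_finrank_orthogonal
    rw [finrank_span_singleton (norm_ne_zero_iff.1 (by simp [hv])), hdim] at h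
    omega
  have hpre : (fun p : ℝ × ↥((ℝ ∙ v)ᗮ) => p.1 • v + (p.2 : E)) ⁻¹' {x : E | 0 < ⟪v, x⟫} =
      Set.Ioi (0 : ℝ) ×ˢ Set.univ := by
    ext p
    simp [inner_smul_add_orthogonal hv p.1 p.2.2]
  have hmeas : MeasurableSet {x : E | 0 < ⟪v, x⟫} :=
    measurableSet_lt measurable_const (by fun_prop)
  rw [← (measurePreserving_smul_add_orthogonal hv).setLIntegral_comp_preimage hmeas (by fun_prop), hpre,
    Measure.volume_eq_prod, setLIntegral_prod _ (by fun_prop),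
    lintegral_lintegral_swap (μ := (volume : Measure ↥((ℝ ∙ v)ᗮ))) (by fun_prop)]
  refine setLIntegral_congr_fun measurableSet_Ioi fun t ht => ?_
  have ht0 : 0 < t := ht
  have hpow : Real.sqrt t ^ (n - 1) = t ^ (((n : ℝ) - 1) / 2) := by
    rw [Real.sqrt_eq_rpow, ← Real.rpow_natCast, ← Real.rpow_mul ht0.le, Nat.cast_sub hn]
    congr 1
    push_cast
    ring
  simp only [Measure.restrict_univ]
  rw [lintegral_eq_pow_mul_lintegral_smul volume (by fun_prop) (Real.sqrt_pos.2 ht0), hrank, hpow,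
    ← lintegral_const_mul _ (by fun_prop)]
  refine lintegral_congr fun w => ?_
  rw [mul_comm (f _), ENNReal.ofReal_mul (by positivity)]
  rfl
end
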